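/- Let n > 2, 1 ≤ s < n-1, x ∈ ℝⁿ, β ∈ ℝˢ with β_j ≥ 0 for all j, and set α_i = e_i(β) for i = 1,…,s (so Condition C holds). Let 2 ≤ k ≤ n. Assume E_1(x) ≥ 0, E_2(x) ≥ 0, …, E_s(x) ≥ 0, and S_{m;s}(x) ≥ 0 for all m = s, s+1, …, k. Then the Maclaurin-type chain holds: S_{1;s}(x) ≥ S_{2;s}(x)^{1/2} ≥ ⋯ ≥ S_{k;s}(x)^{1/k}; that is, S_{j-1;s}(x)^{1/(j-1)} ≥ S_{j;s}(x)^{1/j} for each j = 2,…,k. -/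

import Mathlib

/-- The `k`-th elementary symmetric polynomial of a vector `v ∈ ℝ^m`. -/
noncomputable def esymmFin {m : ℕ} (v : Fin m → ℝ) (k : ℕ) : ℝ :=
  ∑ t ∈ Finset.univ.powersetCard k, ∏ i ∈ t, v i

/-- `σ_k(v)` with integer index: equals `esymmFin v k` for `0 ≤ k` (hence `0` for `k > m`),
and `0` for `k < 0`. -/
noncomputable def sigmaZ {m : ℕ} (v : Fin m → ℝ) (k : ℤ) : ℝ :=
  if 0 ≤ k then esymmFin v k.toNat else 0

/-- The `k`-th elementary symmetric mean `E_k(v) = σ_k(v) / C(m,k)`, integer index. -/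
noncomputable def emeanZ {m : ℕ} (v : Fin m → ℝ) (k : ℤ) : ℝ :=
  if 0 ≤ k then esymmFin v k.toNat / (m.choose k.toNat) else 0

/-- `S_{k;s}(x) = E_k(x) + ∑_{i=1}^s α_i E_{k-i}(x)`. -/
noncomputable def Ssk {n s : ℕ} (x : Fin n → ℝ) (α : Fin s → ℝ) (k : ℤ) : ℝ :=
  emeanZ x k + ∑ i : Fin s, α i * emeanZ x (k - ((i : ℕ) + 1))

/-- `Q_{k;s}(x) = σ_k(x) + ∑_{i=1}^s α_i σ_{k-i}(x)`. -/
noncomputable def Qks {n s : ℕ} (x : Fin n → ℝ) (α : Fin s → ℝ) (k : ℤ) : ℝ :=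
  sigmaZ x k + ∑ i : Fin s, α i * sigmaZ x (k - ((i : ℕ) + 1))

/-- Condition C: `t^s + α_1 t^{s-1} + ⋯ + α_s` has only real roots `-β_1,…,-β_s`;
equivalently `α_i = e_i(β)` for some `β ∈ ℝ^s`. -/
def ConditionC {s : ℕ} (α : Fin s → ℝ) : Prop :=
  ∃ β : Fin s → ℝ, ∀ i : Fin s, α i = esymmFin β ((i : ℕ) + 1)

open Polynomial

/-! ### Real-rooted polynomials -/

/-- By Rolle's theorem, the derivative of a real-rooted polynomial is real-rooted. -/
theorem splits_derivative_of_splits {p : ℝ[X]} (hp : p.Splits) : (derivative p).Splits := by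
  rcases Nat.eq_zero_or_pos p.natDegree with h0 | h0
  · rw [derivative_of_natDegree_zero h0]
    exact Splits.zero
  rw [splits_iff_card_roots]
  refine le_antisymm (card_roots' _) ?_
  have h1 := card_roots_le_derivative p
  rw [splits_iff_card_roots.mp hp] at h1
  have h2 := natDegree_derivative_lt h0.ne'
  omega

theorem splits_reverse_of_splits {p : ℝ[X]} (hp : p.Splits) : p.reverse.Splits := by
  induction hp using Submonoid.closure_induction with
  | mem x hx =>
    refine Splits.of_natDegree_le_one ((reverse_natDegree_le x).trans ?_)
    rcases hx with ⟨a, rfl⟩ | ⟨a, rfl⟩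
    · simp
    · simp
  | one => rw [← C_1, reverse_C]; exact Splits.C 1
  | mul x y _ _ hx hy => rw [reverse_mul_of_domain]; exact hx.mul hy

theorem splits_reflect_of_splits {p : ℝ[X]} (hp : p.Splits) {N : ℕ} (hN : p.natDegree ≤ N) :
    (reflect N p).Splits := by
  have h := reflect_mul p 1 (le_refl p.natDegree) (G := N - p.natDegree) (by simp)
  rw [mul_one, Nat.add_sub_cancel' hN, reflect_one] at h
  rw [h]
  exact (splits_reverse_of_splits hp).mul (Splits.X_pow _)

theorem reflect_derivative_reflect {N : ℕ} {p : ℝ[X]} (hp : p.natDegree ≤ N + 1) :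
    reflect N (derivative (reflect (N + 1) p)) = C (N + 1 : ℝ) * p - X * derivative p := by
  ext i
  have hX : (X * derivative p).coeff i = p.coeff i * i := by
    cases i with
    | zero => simp
    | succ i => rw [coeff_X_mul, coeff_derivative]; push_cast; ring
  rw [coeff_sub, coeff_C_mul, hX, coeff_reflect, coeff_derivative, coeff_reflect]
  rcases le_or_gt i N with hi | hi
  · rw [revAt_le hi, revAt_le (by omega), show N + 1 - (N - i + 1) = i by omega]
    push_cast [hi]
    ring
  · rw [revAt_eq_self_of_lt hi]
    rcases (Nat.succ_le_of_lt hi).eq_or_lt with rfl | hi'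
    · rw [revAt_eq_self_of_lt (by omega), coeff_eq_zero_of_natDegree_lt (by omega)]
      push_cast
      ring
    · rw [revAt_eq_self_of_lt (by omega), coeff_eq_zero_of_natDegree_lt (by omega),
        coeff_eq_zero_of_natDegree_lt (by omega)]
      ring

/-- A polar derivative of a real-rooted polynomial is real-rooted. -/
theorem splits_polar_derivative {N : ℕ} {p : ℝ[X]} (hp : p.Splits) (hN : p.natDegree ≤ N + 1)
    (δ : ℝ) : (C (N + 1 : ℝ) * p + (C δ - X) * derivative p).Splits := by
  have hdeg : (p.comp (X + C δ)).natDegree ≤ N + 1 := by simpa [natDegree_comp] using hN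
  have h := splits_derivative_of_splits (splits_reflect_of_splits (hp.comp_X_add_C δ) hdeg)
  have hd : (derivative (reflect (N + 1) (p.comp (X + C δ)))).natDegree ≤ N := by
    refine (natDegree_derivative_le _).trans ?_
    have := natDegree_reflect_le (p := p.comp (X + C δ)) (N := N + 1)
    omega
  have h' := (splits_reflect_of_splits h hd).comp_X_sub_C δ
  rw [reflect_derivative_reflect hdeg] at h'
  have heq : C (N + 1 : ℝ) * p + (C δ - X) * derivative p
      = (C (N + 1 : ℝ) * p.comp (X + C δ) - X * derivative (p.comp (X + C δ))).comp (X - C δ) := by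
    simp only [derivative_comp, derivative_add, derivative_X, derivative_C, add_zero, one_mul,
      sub_comp, mul_comp, C_comp, X_comp, add_comp, comp_assoc, sub_add_cancel, comp_X]
    ring
  rwa [heq]

/-! ### Sequences of normalized coefficients of real-rooted polynomials -/

/-- The polynomial `∑ C(N,i) a_i X^i` of degree at most `N`. -/
noncomputable def binomPoly (N : ℕ) (a : ℕ → ℝ) : ℝ[X] :=
  ∑ i ∈ Finset.range (N + 1), C (N.choose i * a i) * X ^ i

theorem coeff_binomPoly (N : ℕ) (a : ℕ → ℝ) (i : ℕ) :
    (binomPoly N a).coeff i = N.choose i * a i := by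
  rw [binomPoly, finsetSum_coeff]
  simp only [coeff_C_mul_X_pow]
  rw [Finset.sum_ite_eq]
  split_ifs with h
  · rfl
  · rw [Nat.choose_eq_zero_of_lt (by simpa using h)]
    simp

theorem natDegree_binomPoly_le (N : ℕ) (a : ℕ → ℝ) : (binomPoly N a).natDegree ≤ N := by
  rw [natDegree_le_iff_coeff_eq_zero]
  intro i hi
  rw [coeff_binomPoly, Nat.choose_eq_zero_of_lt hi]
  simp

theorem derivative_binomPoly (N : ℕ) (a : ℕ → ℝ) :
    derivative (binomPoly (N + 1) a) = C (N + 1 : ℝ) * binomPoly N (fun i => a (i + 1)) := by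
  ext i
  rw [coeff_derivative, coeff_C_mul, coeff_binomPoly, coeff_binomPoly]
  have h : ((N + 1 : ℕ) : ℝ) * N.choose i = (N + 1).choose (i + 1) * (i + 1 : ℕ) := by
    exact_mod_cast Nat.add_one_mul_choose_eq N i
  push_cast at h
  linear_combination -(a (i + 1)) * h

theorem sub_X_mul_derivative_binomPoly (N : ℕ) (a : ℕ → ℝ) :
    C (N + 1 : ℝ) * binomPoly (N + 1) a - X * derivative (binomPoly (N + 1) a)
      = C (N + 1 : ℝ) * binomPoly N a := by
  ext i
  cases i with
  | zero => simp [coeff_binomPoly]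
  | succ i =>
    rw [coeff_sub, coeff_C_mul, coeff_C_mul, coeff_X_mul, coeff_derivative, coeff_binomPoly,
      coeff_binomPoly]
    have h : ((N + 1 : ℕ) : ℝ) * N.choose i = (N + 1).choose (i + 1) * (i + 1 : ℕ) := by
      exact_mod_cast Nat.add_one_mul_choose_eq N i
    have h₂ : ((N + 1).choose (i + 1) : ℝ) = N.choose i + N.choose (i + 1) := by
      exact_mod_cast Nat.choose_succ_succ N i
    push_cast at h
    linear_combination a (i + 1) * h + (N + 1) * a (i + 1) * h₂

/-- `∑ C(N,i) a_i X^i` has only real roots. -/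
def IsRealRootedSeq (N : ℕ) (a : ℕ → ℝ) : Prop := (binomPoly N a).Splits

theorem splits_of_splits_C_mul {c : ℝ} (hc : c ≠ 0) {p : ℝ[X]} (h : (C c * p).Splits) :
    p.Splits := by
  have h' := (Splits.C c⁻¹).mul h
  rwa [← mul_assoc, ← C_mul, inv_mul_cancel₀ hc, C_1, one_mul] at h'

namespace IsRealRootedSeq

variable {N : ℕ} {a : ℕ → ℝ}

theorem shift (h : IsRealRootedSeq (N + 1) a) : IsRealRootedSeq N (fun i => a (i + 1)) := by
  have h' := splits_derivative_of_splits h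
  rw [derivative_binomPoly] at h'
  exact splits_of_splits_C_mul (by positivity) h'

theorem truncate (h : IsRealRootedSeq (N + 1) a) : IsRealRootedSeq N a := by
  have h' := splits_polar_derivative h (natDegree_binomPoly_le _ _) 0
  rw [C_0, zero_sub, neg_mul, ← sub_eq_add_neg, sub_X_mul_derivative_binomPoly] at h'
  exact splits_of_splits_C_mul (by positivity) h'

theorem add_shift (h : IsRealRootedSeq (N + 1) a) (b : ℝ) :
    IsRealRootedSeq N (fun i => a (i + 1) + b * a i) := by
  rcases eq_or_ne b 0 with rfl | hb
  · simpa using h.shift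
  have h' := splits_polar_derivative h (natDegree_binomPoly_le _ _) b⁻¹
  refine splits_of_splits_C_mul (c := b⁻¹ * (N + 1)) (by positivity) ?_
  convert h' using 1
  have h1 : binomPoly N (fun i => a (i + 1) + b * a i)
      = binomPoly N (fun i => a (i + 1)) + C b * binomPoly N a := by
    ext i
    simp only [coeff_add, coeff_C_mul, coeff_binomPoly]
    ring
  have h2 : C b⁻¹ * C b = 1 := by rw [← C_mul, inv_mul_cancel₀ hb, C_1]
  rw [sub_mul, add_sub_left_comm, sub_X_mul_derivative_binomPoly, derivative_binomPoly, h1, C_mul]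
  linear_combination C (N + 1 : ℝ) * binomPoly N a * h2

theorem shift_add (m : ℕ) (h : IsRealRootedSeq (N + m) a) :
    IsRealRootedSeq N (fun i => a (i + m)) := by
  induction m generalizing N with
  | zero => exact h
  | succ m ih =>
    have h' := (ih (N := N + 1) (by rwa [add_right_comm])).shift
    simpa only [add_right_comm _ 1 m, ← add_assoc] using h'

theorem mono {M : ℕ} (h : IsRealRootedSeq N a) (hM : M ≤ N) : IsRealRootedSeq M a := by
  induction N, hM using Nat.le_induction with
  | base => exact h
  | succ N _ ih => exact ih h.truncate

/-- Newton's inequality. -/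
theorem newton (h : IsRealRootedSeq N a) {m : ℕ} (hm : m + 2 ≤ N) :
    a m * a (m + 2) ≤ a (m + 1) ^ 2 := by
  have h2 : IsRealRootedSeq 2 (fun i => a (i + m)) :=
    (h.mono (M := 2 + m) (by omega)).shift_add m
  have hev : ∀ t, (binomPoly 2 (fun i => a (i + m))).eval t
      = a m + 2 * a (m + 1) * t + a (m + 2) * t ^ 2 := by
    intro t
    simp [binomPoly, Finset.sum_range_succ, add_comm _ m]
  rcases eq_or_ne (a (m + 2)) 0 with h0 | h0
  · rw [h0, mul_zero]
    positivity
  have hdeg : (binomPoly 2 (fun i => a (i + m))).degree ≠ 0 := by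
    refine (natDegree_pos_iff_degree_pos.mp (lt_of_lt_of_le two_pos ?_)).ne'
    apply le_natDegree_of_ne_zero
    simpa [coeff_binomPoly, add_comm] using h0
  obtain ⟨t, ht⟩ := Splits.exists_eval_eq_zero h2 hdeg
  rw [hev] at ht
  have hsq : a (m + 1) ^ 2 - a m * a (m + 2) = (a (m + 2) * t + a (m + 1)) ^ 2 := by
    linear_combination -(a (m + 2)) * ht
  linarith [sq_nonneg (a (m + 2) * t + a (m + 1))]

theorem apply_le_zero_of_gap {d : ℕ} (hd : 2 ≤ d) (h : IsRealRootedSeq d a) (h0 : 0 < a 0)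
    (hz : ∀ i, 0 < i → i < d → a i = 0) : a d ≤ 0 := by
  induction d, hd using Nat.le_induction generalizing a with
  | base =>
    have := h.newton (m := 0) le_rfl
    rw [zero_add, hz 1 one_pos one_lt_two] at this
    nlinarith
  | succ d hd ih =>
    have := ih (h.add_shift 1) (by simpa [hz 1 one_pos (by omega)] using h0) (by
      intro i hi hid
      simp [hz i hi (by omega), hz (i + 1) (by omega) (by omega)])
    simpa [hz d (by omega) (by omega)] using this

/-- A real-rooted sequence that is nonnegative up to a zero is nonpositive right after it. -/
theorem apply_succ_le_zero (h : IsRealRootedSeq N a) (h0 : 0 < a 0) {m : ℕ}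
    (hnn : ∀ i ≤ m, 0 ≤ a i) (hmN : m + 1 ≤ N) (hm : a m = 0) : a (m + 1) ≤ 0 := by
  classical
  set p := Nat.findGreatest (fun i => 0 < a i) m with hp
  have hpm : p ≤ m := Nat.findGreatest_le m
  have hap : 0 < a p := Nat.findGreatest_spec (P := fun i => 0 < a i) (Nat.zero_le m) h0
  have hpm' : p ≠ m := by
    rintro h
    rw [h, hm] at hap
    exact lt_irrefl _ hap
  have h1 : IsRealRootedSeq (m + 1 - p) (fun i => a (i + p)) :=
    (h.mono (M := m + 1 - p + p) (by omega)).shift_add p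
  have h2 := h1.apply_le_zero_of_gap (by omega) (by simpa using hap) (by
    intro i hi him
    exact le_antisymm (not_lt.mp (Nat.findGreatest_is_greatest
      (P := fun i => 0 < a i) (n := m) (k := i + p) (by omega) (by omega))) (hnn _ (by omega)))
  simpa [Nat.sub_add_cancel (show p ≤ m + 1 by omega)] using h2

end IsRealRootedSeq

/-! ### Multiplying a generating sequence by linear factors -/

/-- The coefficients of `(1 + bX) ∑ a_i X^i`. -/
def mulLinear (b : ℝ) (a : ℕ → ℝ) : ℕ → ℝ
  | 0 => a 0
  | i + 1 => a (i + 1) + b * a i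

/-- The coefficients of `∏_{b ∈ L} (1 + bX) ∑ a_i X^i`. -/
def mulLinears (L : List ℝ) (a : ℕ → ℝ) : ℕ → ℝ := L.foldr mulLinear a

theorem mulLinear_zero (a : ℕ → ℝ) : mulLinear 0 a = a := by
  funext i
  cases i <;> simp [mulLinear]

theorem mulLinears_cons_succ (b : ℝ) (L : List ℝ) (a : ℕ → ℝ) (m : ℕ) :
    mulLinears (b :: L) a (m + 1) = mulLinears L a (m + 1) + b * mulLinears L a m := rfl

theorem mulLinears_apply_zero (L : List ℝ) (a : ℕ → ℝ) : mulLinears L a 0 = a 0 := by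
  induction L with
  | nil => rfl
  | cons b L ih => exact ih

theorem mulLinears_filter_pos {L : List ℝ} (hL : ∀ b ∈ L, 0 ≤ b) (a : ℕ → ℝ) :
    mulLinears (L.filter (fun b => 0 < b)) a = mulLinears L a := by
  induction L with
  | nil => rfl
  | cons b L ih =>
    have ih' := ih fun c hc => hL c (List.mem_cons_of_mem _ hc)
    rcases (hL b List.mem_cons_self).eq_or_lt with rfl | hb
    · have : mulLinears (0 :: L) a = mulLinears L a := mulLinear_zero _
      rw [this, ← ih']
      simp
    · rw [List.filter_cons_of_pos (by simpa using hb)]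
      exact congrArg (mulLinear b) ih'

theorem IsRealRootedSeq.mulLinears {N : ℕ} {a : ℕ → ℝ} (L : List ℝ)
    (h : IsRealRootedSeq (N + L.length) a) :
    IsRealRootedSeq N (fun i => mulLinears L a (i + L.length)) := by
  induction L generalizing N with
  | nil => exact h
  | cons b L ih =>
    rw [List.length_cons, add_left_comm, add_comm, add_right_comm] at h
    have h' := (ih (N := N + 1) (by rwa [add_right_comm])).add_shift b
    simpa only [List.length_cons, ← add_assoc, mulLinears_cons_succ,
      add_right_comm _ 1 L.length] using h'

theorem mulLinears_le_of_le {L : List ℝ} (hL : ∀ b ∈ L, 0 ≤ b) {a c : ℕ → ℝ} {M : ℕ}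
    (hac : ∀ j ≤ M, a j ≤ c j) : ∀ j ≤ M, mulLinears L a j ≤ mulLinears L c j := by
  induction L with
  | nil => exact hac
  | cons b L ih =>
    have ih' := ih fun c hc => hL c (List.mem_cons_of_mem _ hc)
    intro j hj
    cases j with
    | zero => exact ih' 0 hj
    | succ j =>
      rw [mulLinears_cons_succ, mulLinears_cons_succ]
      exact add_le_add (ih' _ hj)
        (mul_le_mul_of_nonneg_left (ih' j (by omega)) (hL b List.mem_cons_self))

theorem mulLinears_nonneg {L : List ℝ} (hL : ∀ b ∈ L, 0 ≤ b) {a : ℕ → ℝ} {M : ℕ}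
    (ha : ∀ j ≤ M, 0 ≤ a j) : ∀ j ≤ M, 0 ≤ mulLinears L a j := by
  induction L with
  | nil => exact ha
  | cons b L ih =>
    have ih' := ih fun c hc => hL c (List.mem_cons_of_mem _ hc)
    intro j hj
    cases j with
    | zero => exact ih' 0 hj
    | succ j =>
      rw [mulLinears_cons_succ]
      exact add_nonneg (ih' _ hj) (mul_nonneg (hL b List.mem_cons_self) (ih' j (by omega)))

theorem mulLinears_pos {L : List ℝ} (hL : ∀ b ∈ L, 0 < b) {a : ℕ → ℝ} (h0 : 0 < a 0)
    (ha : ∀ j ≤ L.length, 0 ≤ a j) : ∀ j ≤ L.length, 0 < mulLinears L a j := by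
  induction L with
  | nil =>
    intro j hj
    rw [Nat.le_zero.mp hj]
    exact h0
  | cons b L ih =>
    have hL' : ∀ c ∈ L, 0 < c := fun c hc => hL c (List.mem_cons_of_mem _ hc)
    rw [List.length_cons] at ha ⊢
    have ih' := ih hL' fun j hj => ha j (by omega)
    intro j hj
    cases j with
    | zero => exact ih' 0 (Nat.zero_le _)
    | succ j =>
      rw [mulLinears_cons_succ]
      exact add_pos_of_nonneg_of_pos (mulLinears_nonneg (fun c hc => (hL' c hc).le) ha _ hj)
        (mul_pos (hL b List.mem_cons_self) (ih' j (by omega)))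

/-! ### Log-concave sequences without internal zeros -/

/-- Log-concavity without internal zeros, for sequences extended by `0` to negative indices. -/
structure IsLogConcaveSeq (c : ℕ → ℝ) : Prop where
  nonneg : ∀ i, 0 ≤ c i
  mul_le : ∀ i j, i ≤ j → c i * c (j + 2) ≤ c (i + 1) * c (j + 1)

theorem IsLogConcaveSeq.of_newton {c : ℕ → ℝ} (hnn : ∀ i, 0 ≤ c i)
    (hN : ∀ i, c i * c (i + 2) ≤ c (i + 1) ^ 2) (hz : ∀ i, c i = 0 → c (i + 1) = 0) :
    IsLogConcaveSeq c := by
  refine ⟨hnn, fun i j hij => ?_⟩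
  induction j, hij using Nat.le_induction with
  | base => rw [← sq]; exact hN i
  | succ j _ ih =>
    rcases (hnn (j + 2)).eq_or_lt with h | h
    · rw [show c (j + 1 + 2) = 0 from hz (j + 2) h.symm, mul_zero]
      exact mul_nonneg (hnn _) (hnn _)
    · have h1 := mul_le_mul_of_nonneg_right ih (hnn (j + 3))
      have h2 := mul_le_mul_of_nonneg_left (hN (j + 1)) (hnn (i + 1))
      refine le_of_mul_le_mul_right ?_ h
      calc c i * c (j + 3) * c (j + 2) = c i * c (j + 2) * c (j + 3) := by ring
        _ ≤ c (i + 1) * c (j + 1) * c (j + 3) := h1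
        _ = c (i + 1) * (c (j + 1) * c (j + 3)) := by ring
        _ ≤ c (i + 1) * c (j + 2) ^ 2 := h2
        _ = c (i + 1) * c (j + 2) * c (j + 2) := by ring

theorem IsLogConcaveSeq.mulLinear {c : ℕ → ℝ} (hc : IsLogConcaveSeq c) {b : ℝ} (hb : 0 ≤ b) :
    IsLogConcaveSeq (mulLinear b c) := by
  refine ⟨fun i => ?_, fun i j hij => ?_⟩
  · cases i with
    | zero => exact hc.nonneg 0
    | succ i => exact add_nonneg (hc.nonneg _) (mul_nonneg hb (hc.nonneg _))
  · cases i with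
    | zero =>
      change c 0 * (c (j + 2) + b * c (j + 1)) ≤ (c 1 + b * c 0) * (c (j + 1) + b * c j)
      have h1 := hc.mul_le 0 j (Nat.zero_le j)
      have h2 := mul_nonneg hb (mul_nonneg (hc.nonneg 1) (hc.nonneg j))
      have h3 := mul_nonneg (sq_nonneg b) (mul_nonneg (hc.nonneg 0) (hc.nonneg j))
      rw [zero_add] at h1
      linarith
    | succ i =>
      obtain ⟨j, rfl⟩ : ∃ l, j = l + 1 := ⟨j - 1, by omega⟩
      change (c (i + 1) + b * c i) * (c (j + 3) + b * c (j + 2))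
        ≤ (c (i + 2) + b * c (i + 1)) * (c (j + 2) + b * c (j + 1))
      have h1 := hc.mul_le (i + 1) (j + 1) hij
      have h2 := hc.mul_le i j (by omega)
      have h3 : c i * c (j + 3) ≤ c (i + 2) * c (j + 1) := by
        have h4 := hc.mul_le i (j + 1) (by omega)
        rcases (show i ≤ j by omega).eq_or_lt with rfl | h
        · rw [mul_comm (c (i + 2))]
          exact h4
        · exact h4.trans (hc.mul_le (i + 1) j h)
      have h5 := mul_le_mul_of_nonneg_left h3 hb
      have h6 := mul_le_mul_of_nonneg_left h2 (sq_nonneg b)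
      simp only [add_assoc, Nat.reduceAdd] at h1
      linarith

theorem IsLogConcaveSeq.mulLinears {c : ℕ → ℝ} (hc : IsLogConcaveSeq c) {L : List ℝ}
    (hL : ∀ b ∈ L, 0 ≤ b) : IsLogConcaveSeq (mulLinears L c) := by
  induction L with
  | nil => exact hc
  | cons b L ih =>
    exact (ih fun c hc => hL c (List.mem_cons_of_mem _ hc)).mulLinear (hL b List.mem_cons_self)

/-! ### Newton's inequalities and zeros for products with linear factors -/

theorem IsRealRootedSeq.isLogConcaveSeq_truncation {N : ℕ} {a : ℕ → ℝ}
    (h : IsRealRootedSeq N a) (h0 : 0 < a 0) {M : ℕ} (hM : M + 1 ≤ N)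
    (hnn : ∀ i ≤ M, 0 ≤ a i) :
    IsLogConcaveSeq (fun i => if i ≤ M + 1 then max (a i) 0 else 0) := by
  have hc : ∀ i ≤ M, (if i ≤ M + 1 then max (a i) 0 else 0) = a i := fun i hi => by
    rw [if_pos (by omega), max_eq_left (hnn i hi)]
  refine IsLogConcaveSeq.of_newton (fun i => ?_) (fun i => ?_) (fun i hi => ?_)
  · split_ifs
    · exact le_max_right _ _
    · exact le_rfl
  · rcases le_or_gt (i + 2) (M + 1) with hi | hi
    · rw [hc i (by omega), hc (i + 1) (by omega), if_pos hi]
      rcases max_cases (a (i + 2)) 0 with ⟨h1, -⟩ | ⟨h1, -⟩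
      · rw [h1]
        exact h.newton (by omega)
      · rw [h1, mul_zero]
        positivity
    · rw [if_neg (by omega : ¬ i + 2 ≤ M + 1), mul_zero]
      positivity
  · rcases le_or_gt (i + 1) (M + 1) with hi' | hi'
    · rw [if_pos hi']
      rw [hc i (by omega)] at hi
      exact max_eq_right (h.apply_succ_le_zero h0 (fun j hj => hnn j (by omega)) (by omega) hi)
    · exact if_neg (by omega)

section

variable {n : ℕ} {a : ℕ → ℝ} {L : List ℝ}

theorem IsRealRootedSeq.newton_mulLinears (h : IsRealRootedSeq n a) (h0 : 0 < a 0)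
    (hL : ∀ b ∈ L, 0 ≤ b) (hLn : L.length ≤ n) (ha : ∀ j ≤ L.length, 0 ≤ a j) {m : ℕ}
    (hm : m + 2 ≤ n) :
    _root_.mulLinears L a m * _root_.mulLinears L a (m + 2)
      ≤ _root_.mulLinears L a (m + 1) ^ 2 := by
  rcases le_or_gt L.length m with hr | hr
  · have h1 : IsRealRootedSeq (n - L.length) (fun i => _root_.mulLinears L a (i + L.length)) :=
      IsRealRootedSeq.mulLinears L (by rwa [Nat.sub_add_cancel hLn])
    have h2 := h1.newton (m := m - L.length) (by omega)
    simpa only [add_right_comm _ _ L.length, Nat.sub_add_cancel hr] using h2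
  · have hnn : ∀ i ≤ m + 1, 0 ≤ a i := fun i hi => ha i (by omega)
    have hc := (h.isLogConcaveSeq_truncation h0 hm hnn).mulLinears hL
    set c : ℕ → ℝ := fun i => if i ≤ m + 1 + 1 then max (a i) 0 else 0
    have hac : ∀ j ≤ m + 2, a j ≤ c j := fun j hj => by
      simp only [c, if_pos hj]
      exact le_max_left _ _
    have hca : ∀ j ≤ m + 1, c j ≤ a j := fun j hj => by
      simp only [c, if_pos (show j ≤ m + 1 + 1 by omega), max_eq_left (hnn j hj), le_refl]
    have hle := mulLinears_le_of_le hL hac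
    have hge := mulLinears_le_of_le hL hca
    have h1 := le_antisymm (hle m (by omega)) (hge m (by omega))
    have h2 := le_antisymm (hle (m + 1) (by omega)) (hge (m + 1) (by omega))
    rw [h1, h2, sq]
    exact (mul_le_mul_of_nonneg_left (hle (m + 2) le_rfl) (hc.nonneg m)).trans
      (hc.mul_le m m le_rfl)

theorem IsRealRootedSeq.mulLinears_succ_le_zero (h : IsRealRootedSeq n a) (h0 : 0 < a 0)
    (hL : ∀ b ∈ L, 0 < b) (hLn : L.length ≤ n) (ha : ∀ j ≤ L.length, 0 ≤ a j) {m : ℕ}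
    (hm : m + 1 ≤ n) (hT : ∀ i ≤ m, 0 ≤ _root_.mulLinears L a i)
    (hz : _root_.mulLinears L a m = 0) : _root_.mulLinears L a (m + 1) ≤ 0 := by
  have hpos := mulLinears_pos hL h0 ha
  rcases le_or_gt m L.length with hr | hr
  · exact absurd hz (hpos m hr).ne'
  · have h1 : IsRealRootedSeq (n - L.length) (fun i => _root_.mulLinears L a (i + L.length)) :=
      IsRealRootedSeq.mulLinears L (by rwa [Nat.sub_add_cancel hLn])
    have h2 := h1.apply_succ_le_zero (m := m - L.length)
      (by simpa using hpos L.length le_rfl) (fun i hi => hT _ (by omega)) (by omega)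
      (by simpa only [Nat.sub_add_cancel hr.le] using hz)
    simpa only [add_right_comm _ _ L.length, Nat.sub_add_cancel hr.le] using h2

end

/-! ### From Newton's inequalities to Maclaurin's inequalities -/

theorem pow_le_pow_of_newton {T : ℕ → ℝ} {k : ℕ} (h0 : T 0 = 1) (hnn : ∀ i ≤ k, 0 ≤ T i)
    (hN : ∀ i, i + 2 ≤ k → T i * T (i + 2) ≤ T (i + 1) ^ 2)
    (hz : ∀ i, i + 1 ≤ k → T i = 0 → T (i + 1) = 0) :
    ∀ j, j + 1 ≤ k → T (j + 1) ^ j ≤ T j ^ (j + 1) := by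
  intro j
  induction j with
  | zero => simp [h0]
  | succ j ih =>
    intro hj
    have ih' := ih (by omega)
    rcases (hnn (j + 1) (by omega)).eq_or_lt with h | h
    · rw [hz (j + 1) hj h.symm, ← h, zero_pow (by omega), zero_pow (by omega)]
    have hpos : 0 < T j := (hnn j (by omega)).lt_of_ne' fun h' => h.ne' (hz j (by omega) h')
    have h1 := pow_le_pow_left₀ (mul_nonneg hpos.le (hnn (j + 2) hj)) (hN j hj) (j + 1)
    refine le_of_mul_le_mul_left ?_ (pow_pos hpos (j + 1))
    calc T j ^ (j + 1) * T (j + 1 + 1) ^ (j + 1)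
        = (T j * T (j + 2)) ^ (j + 1) := (mul_pow _ _ _).symm
      _ ≤ (T (j + 1) ^ 2) ^ (j + 1) := h1
      _ = T (j + 1) ^ j * T (j + 1) ^ (j + 1 + 1) := by ring
      _ ≤ T j ^ (j + 1) * T (j + 1) ^ (j + 1 + 1) :=
        mul_le_mul_of_nonneg_right ih' (pow_nonneg h.le _)

theorem rpow_one_div_le_of_pow_le {u v : ℝ} (hu : 0 ≤ u) (hv : 0 ≤ v) {j : ℕ} (hj : j ≠ 0)
    (h : v ^ j ≤ u ^ (j + 1)) :
    v ^ ((1 : ℝ) / (j + 1 : ℕ)) ≤ u ^ ((1 : ℝ) / j) := by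
  have hj' : (j : ℝ) ≠ 0 := Nat.cast_ne_zero.mpr hj
  have h1 := Real.rpow_le_rpow (pow_nonneg hv j) h
    (show (0 : ℝ) ≤ 1 / (j * (j + 1 : ℕ)) by positivity)
  rw [← Real.rpow_natCast v, ← Real.rpow_natCast u, ← Real.rpow_mul hv, ← Real.rpow_mul hu] at h1
  convert h1 using 2 <;> field_simp

/-! ### Elementary symmetric means -/

theorem esymmFin_eq_esymm {m : ℕ} (v : Fin m → ℝ) (k : ℕ) :
    esymmFin v k = (Finset.univ.val.map v).esymm k :=
  (Finset.esymm_map_val v Finset.univ k).symm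

theorem esymmFin_zero {m : ℕ} (v : Fin m → ℝ) : esymmFin v 0 = 1 := by
  simp [esymmFin]

theorem esymmFin_eq_zero {m : ℕ} (v : Fin m → ℝ) {k : ℕ} (hk : m < k) : esymmFin v k = 0 := by
  rw [esymmFin, Finset.powersetCard_eq_empty.mpr (by simpa using hk), Finset.sum_empty]

theorem esymmFin_succ {m : ℕ} (v : Fin (m + 1) → ℝ) (k : ℕ) :
    esymmFin v (k + 1)
      = esymmFin (fun i => v i.succ) (k + 1) + v 0 * esymmFin (fun i => v i.succ) k := by
  have h : (Finset.univ : Finset (Fin (m + 1))).val.map v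
      = v 0 ::ₘ (Finset.univ : Finset (Fin m)).val.map (fun i => v i.succ) := by
    rw [Fin.univ_succ]
    simp [Function.comp_def]
  rw [esymmFin_eq_esymm, esymmFin_eq_esymm, esymmFin_eq_esymm, h]
  simp only [Multiset.esymm, Multiset.powersetCard_cons, Multiset.map_add, Multiset.sum_add,
    Multiset.map_map, Function.comp_def, Multiset.prod_cons, Multiset.sum_map_mul_left]

theorem coeff_prod_one_add_C_mul_X {m : ℕ} (v : Fin m → ℝ) (k : ℕ) :
    (∏ i, (1 + C (v i) * X : ℝ[X])).coeff k = esymmFin v k := by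
  induction m generalizing k with
  | zero =>
    cases k with
    | zero => simp [esymmFin_zero]
    | succ k => simp [esymmFin_eq_zero, coeff_one]
  | succ m ih =>
    rw [Fin.prod_univ_succ, add_mul, one_mul, mul_assoc, coeff_add, coeff_C_mul, ih]
    cases k with
    | zero => simp [esymmFin_zero]
    | succ k => rw [coeff_X_mul, ih, esymmFin_succ]

theorem isRealRootedSeq_emeanZ {n : ℕ} (x : Fin n → ℝ) :
    IsRealRootedSeq n (fun i => emeanZ x i) := by
  have h : binomPoly n (fun i => emeanZ x i) = ∏ i, (1 + C (x i) * X : ℝ[X]) := by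
    ext i
    rw [coeff_binomPoly, coeff_prod_one_add_C_mul_X]
    simp only [emeanZ, Int.natCast_nonneg, if_true, Int.toNat_natCast]
    rcases le_or_gt i n with hi | hi
    · exact mul_div_cancel₀ _ (Nat.cast_ne_zero.mpr (Nat.choose_pos hi).ne')
    · simp [esymmFin_eq_zero x hi]
  rw [IsRealRootedSeq, h]
  refine Splits.prod fun i _ => Splits.of_natDegree_le_one ?_
  compute_degree

theorem mulLinears_ofFn {s : ℕ} (β : Fin s → ℝ) (a : ℕ → ℝ) (m : ℕ) :
    mulLinears (List.ofFn β) a m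
      = ∑ i ∈ Finset.range (m + 1), esymmFin β i * a (m - i) := by
  induction s generalizing m with
  | zero =>
    rw [Finset.sum_range_succ']
    simp [esymmFin_zero, esymmFin_eq_zero, mulLinears]
  | succ s ih =>
    rw [List.ofFn_succ]
    cases m with
    | zero => simp [mulLinears_apply_zero, esymmFin_zero]
    | succ m =>
      rw [mulLinears_cons_succ, ih, ih, Finset.sum_range_succ', Finset.sum_range_succ' _ (m + 1)]
      simp only [esymmFin_succ, esymmFin_zero, add_mul, Finset.sum_add_distrib, Finset.mul_sum,
        mul_assoc, Nat.add_sub_add_right]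
      ring

theorem Ssk_eq_mulLinears {n s : ℕ} (x : Fin n → ℝ) (β α : Fin s → ℝ)
    (hα : ∀ i : Fin s, α i = esymmFin β ((i : ℕ) + 1)) (m : ℕ) :
    Ssk x α (m : ℤ) = mulLinears (List.ofFn β) (fun i => emeanZ x i) m := by
  have h1 : Ssk x α (m : ℤ)
      = ∑ i ∈ Finset.range (s + 1), esymmFin β i * emeanZ x ((m : ℤ) - i) := by
    rw [Ssk, Finset.sum_range_succ', ← Fin.sum_univ_eq_sum_range
      (fun i => esymmFin β (i + 1) * emeanZ x ((m : ℤ) - (i + 1 : ℕ))) s]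
    simp [hα, esymmFin_zero, add_comm]
  have h2 : mulLinears (List.ofFn β) (fun i => emeanZ x i) m
      = ∑ i ∈ Finset.range (m + 1), esymmFin β i * emeanZ x ((m : ℤ) - i) := by
    rw [mulLinears_ofFn]
    refine Finset.sum_congr rfl fun i hi => ?_
    rw [Nat.cast_sub (by simpa [Nat.lt_succ_iff] using hi)]
  rw [h1, h2]
  have h3 : ∀ M, s ≤ M → ∑ i ∈ Finset.range (s + 1), esymmFin β i * emeanZ x ((m : ℤ) - i)
      = ∑ i ∈ Finset.range (M + 1), esymmFin β i * emeanZ x ((m : ℤ) - i) := fun M hM =>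
    Finset.sum_subset (Finset.range_mono (by omega)) fun i _ hi => by
      rw [esymmFin_eq_zero β (by simpa [Nat.lt_succ_iff] using hi), zero_mul]
  have h4 : ∀ M, m ≤ M → ∑ i ∈ Finset.range (m + 1), esymmFin β i * emeanZ x ((m : ℤ) - i)
      = ∑ i ∈ Finset.range (M + 1), esymmFin β i * emeanZ x ((m : ℤ) - i) := fun M hM =>
    Finset.sum_subset (Finset.range_mono (by omega)) fun i _ hi => by
      rw [Finset.mem_range] at hi
      rw [emeanZ, if_neg (by omega), mul_zero]
  rw [h3 (max s m) (le_max_left _ _), h4 (max s m) (le_max_right _ _)]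

/-- Maclaurin-type inequalities for `S_{k;s}`:
`S_{1;s}(x) ≥ S_{2;s}(x)^{1/2} ≥ ⋯ ≥ S_{k;s}(x)^{1/k}`. -/
theorem maclaurin_inequality_Ssk (n s : ℕ) (hn : 2 < n) (hs1 : 1 ≤ s) (hs2 : s < n - 1)
    (x : Fin n → ℝ) (β : Fin s → ℝ) (hβ : ∀ j : Fin s, 0 ≤ β j)
    (α : Fin s → ℝ) (hα : ∀ i : Fin s, α i = esymmFin β ((i : ℕ) + 1))
    (k : ℕ) (hk2 : 2 ≤ k) (hkn : k ≤ n)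
    (hE : ∀ j : ℕ, 1 ≤ j → j ≤ s → 0 ≤ emeanZ x (j : ℤ))
    (hS : ∀ m : ℕ, s ≤ m → m ≤ k → 0 ≤ Ssk x α (m : ℤ)) :
    ∀ j : ℕ, 2 ≤ j → j ≤ k →
      Ssk x α (j : ℤ) ^ ((1 : ℝ) / (j : ℝ))
        ≤ Ssk x α ((j : ℤ) - 1) ^ ((1 : ℝ) / ((j : ℝ) - 1)) := by
  have hSk := Ssk_eq_mulLinears x β α hα
  set a : ℕ → ℝ := fun i => emeanZ x i with ha_def
  have ha0 : a 0 = 1 := by simp [ha_def, emeanZ, esymmFin_zero]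
  have ha : ∀ j ≤ s, 0 ≤ a j := fun j hj => by
    rcases Nat.eq_zero_or_pos j with rfl | h
    · rw [ha0]
      exact zero_le_one
    · exact hE j h hj
  have hβL : ∀ b ∈ List.ofFn β, 0 ≤ b := by
    simpa [List.mem_ofFn] using hβ
  have hnn : ∀ m ≤ k, 0 ≤ Ssk x α (m : ℤ) := fun m hm => by
    rcases le_or_gt s m with h | h
    · exact hS m h hm
    · rw [hSk]
      exact mulLinears_nonneg hβL ha m h.le
  set L := (List.ofFn β).filter (fun b => 0 < b) with hL_def
  have hLs : L.length ≤ s := by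
    simpa using List.length_filter_le (fun b => decide (0 < b)) (List.ofFn β)
  have hL : ∀ b ∈ L, 0 < b := fun b hb => by simpa using (List.mem_filter.mp hb).2
  have hT : ∀ m : ℕ, Ssk x α (m : ℤ) = mulLinears L a m := fun m => by
    rw [hSk, hL_def, mulLinears_filter_pos hβL]
  have hrr : IsRealRootedSeq n a := isRealRootedSeq_emeanZ x
  have ha0' : 0 < a 0 := ha0 ▸ zero_lt_one
  have haL : ∀ j ≤ L.length, 0 ≤ a j := fun j hj => ha j (hj.trans hLs)
  simp only [hT] at hnn
  have hpow := pow_le_pow_of_newton (T := mulLinears L a) (k := k)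
    (by rw [mulLinears_apply_zero, ha0]) hnn
    (fun i hi => hrr.newton_mulLinears ha0' (fun b hb => (hL b hb).le) (by omega) haL (by omega))
    (fun i hi hz => le_antisymm (hrr.mulLinears_succ_le_zero ha0' hL (by omega) haL (by omega)
      (fun l hl => hnn l (by omega)) hz) (hnn _ hi))
  intro j hj2 hjk
  obtain ⟨j, rfl⟩ : ∃ l, j = l + 1 := ⟨j - 1, by omega⟩
  have h := rpow_one_div_le_of_pow_le (hnn j (by omega)) (hnn (j + 1) hjk) (by omega)
    (hpow j hjk)
  rw [← hT, ← hT] at h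
  simpa using h
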